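/- Let O be a Noetherian local ring, P a bounded complex of finite free O-modules, and u: P → P a chain map whose derived reduction u ⊗^L k to the residue field k is an isomorphism in the derived category D(k). Then u is a quasi-isomorphism. -/

import Mathlib

open CategoryTheory IsLocalRing

open TensorProduct in
/-- Over a local ring, every linear map between the residue fibres of `M` and `N` lifts to a
linear map `M → N` when `M` is projective. -/
lemma exists_baseChange_residueField_eq {R M N : Type*} [CommRing R] [IsLocalRing R]
    [AddCommGroup M] [Module R M] [AddCommGroup N] [Module R N] [Module.Projective R M]
    (h : ResidueField R ⊗[R] M →ₗ[ResidueField R] ResidueField R ⊗[R] N) :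
    ∃ l : M →ₗ[R] N, l.baseChange (ResidueField R) = h := by
  obtain ⟨l, hl⟩ := Module.projective_lifting_property
    (TensorProduct.mk R (ResidueField R) N 1)
    (h.restrictScalars R ∘ₗ TensorProduct.mk R (ResidueField R) M 1)
    (TensorProduct.mk_surjective R N (ResidueField R) Ideal.Quotient.mk_surjective)
  refine ⟨l, ?_⟩
  ext x
  simpa using LinearMap.congr_fun hl x

open TensorProduct in
/-- An endomorphism of a finite module over a Noetherian local ring inducing the identity on the
residue fibre is bijective. -/
lemma bijective_of_baseChange_residueField_eq_id {R M : Type*} [CommRing R] [IsLocalRing R]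
    [IsNoetherianRing R] [AddCommGroup M] [Module R M] [Module.Finite R M] {φ : M →ₗ[R] M}
    (h : φ.baseChange (ResidueField R) = LinearMap.id) : Function.Bijective φ := by
  have hsurj : Function.Surjective φ := by
    rw [← LinearMap.range_eq_top, ← IsLocalRing.map_tensorProduct_mk_eq_top, eq_top_iff]
    rintro y -
    obtain ⟨x, rfl⟩ :=
      TensorProduct.mk_surjective R M (ResidueField R) Ideal.Quotient.mk_surjective y
    exact ⟨φ x, ⟨x, rfl⟩, by simpa using LinearMap.congr_fun h (1 ⊗ₜ x)⟩
  exact ⟨IsNoetherian.injective_of_surjective_endomorphism φ hsurj, hsurj⟩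

/-- Every linear map of vector spaces has a generalized inverse. -/
lemma exists_comp_comp_eq_self {K V W : Type*} [Field K] [AddCommGroup V] [Module K V]
    [AddCommGroup W] [Module K W] (f : V →ₗ[K] W) : ∃ s : W →ₗ[K] V, ∀ x, f (s (f x)) = f x := by
  obtain ⟨t, ht⟩ := f.rangeRestrict.exists_rightInverse_of_surjective f.range_rangeRestrict
  obtain ⟨s, hs⟩ := LinearMap.exists_extend t
  refine ⟨s, fun x => ?_⟩
  have h₁ : s (f x) = t (f.rangeRestrict x) := LinearMap.congr_fun hs (f.rangeRestrict x)
  rw [h₁]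
  exact congrArg Subtype.val (LinearMap.congr_fun ht (f.rangeRestrict x))

/-- An exact sequence of four vector spaces admits a contracting homotopy at the two middle
terms. -/
lemma exists_contraction_of_exact {K A B C D : Type*} [Field K]
    [AddCommGroup A] [Module K A] [AddCommGroup B] [Module K B]
    [AddCommGroup C] [Module K C] [AddCommGroup D] [Module K D]
    {f : A →ₗ[K] B} {g : B →ₗ[K] C} {k : C →ₗ[K] D}
    (hfg : Function.Exact f g) (hgk : Function.Exact g k) :
    ∃ (p : B →ₗ[K] A) (q : C →ₗ[K] B) (r : D →ₗ[K] C),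
      f ∘ₗ p + q ∘ₗ g = LinearMap.id ∧ g ∘ₗ q + r ∘ₗ k = LinearMap.id := by
  obtain ⟨s, hs⟩ := exists_comp_comp_eq_self f
  obtain ⟨t, ht⟩ := exists_comp_comp_eq_self g
  obtain ⟨r, hr⟩ := exists_comp_comp_eq_self k
  refine ⟨s ∘ₗ (LinearMap.id - t ∘ₗ g), t ∘ₗ (LinearMap.id - r ∘ₗ k), r, ?_, ?_⟩
  · ext x
    obtain ⟨a, ha⟩ := (hfg (x - t (g x))).1 (by rw [map_sub, ht, sub_self])
    have hk : k (g x) = 0 := hgk.apply_apply_eq_zero x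
    have hfs : f (s (x - t (g x))) = x - t (g x) := by rw [← ha, hs]
    simp only [LinearMap.add_apply, LinearMap.comp_apply, LinearMap.sub_apply, LinearMap.id_apply,
      hfs, hk, map_zero, sub_zero, sub_add_cancel]
  · ext x
    obtain ⟨b, hb⟩ := (hgk (x - r (k x))).1 (by rw [map_sub, hr, sub_self])
    have hgt : g (t (x - r (k x))) = x - r (k x) := by rw [← hb, ht]
    simp only [LinearMap.add_apply, LinearMap.comp_apply, LinearMap.sub_apply, LinearMap.id_apply,
      hgt, sub_add_cancel]

/-- Let `A → B → C → D` be a complex of projective modules over a Noetherian local ring, with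
`B` and `C` finite. If its residue fibre is exact at the two middle terms, then the complex is
exact at `B`. -/
lemma exact_of_exact_baseChange_residueField {R A B C D : Type*} [CommRing R] [IsLocalRing R]
    [IsNoetherianRing R] [AddCommGroup A] [Module R A] [AddCommGroup B] [Module R B]
    [AddCommGroup C] [Module R C] [AddCommGroup D] [Module R D]
    [Module.Projective R B] [Module.Projective R C] [Module.Projective R D]
    [Module.Finite R B] [Module.Finite R C]
    {f : A →ₗ[R] B} {g : B →ₗ[R] C} {k : C →ₗ[R] D}
    (hfg : g ∘ₗ f = 0) (hgk : k ∘ₗ g = 0)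
    (hfg' : Function.Exact (f.baseChange (ResidueField R)) (g.baseChange (ResidueField R)))
    (hgk' : Function.Exact (g.baseChange (ResidueField R)) (k.baseChange (ResidueField R))) :
    Function.Exact f g := by
  obtain ⟨p', q', r', h₁, h₂⟩ := exists_contraction_of_exact hfg' hgk'
  obtain ⟨p, rfl⟩ := exists_baseChange_residueField_eq p'
  obtain ⟨q, rfl⟩ := exists_baseChange_residueField_eq q'
  obtain ⟨r, rfl⟩ := exists_baseChange_residueField_eq r'
  rw [← LinearMap.baseChange_comp, ← LinearMap.baseChange_comp, ← LinearMap.baseChange_add]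
    at h₁ h₂
  have hB := bijective_of_baseChange_residueField_eq_id h₁
  have hC := bijective_of_baseChange_residueField_eq_id h₂
  have hfg₀ (a : A) : g (f a) = 0 := LinearMap.congr_fun hfg a
  have hgk₀ (b : B) : k (g b) = 0 := LinearMap.congr_fun hgk b
  intro y
  refine ⟨fun hy => ?_, ?_⟩
  · obtain ⟨x, rfl⟩ := hB.2 y
    have hx : g x = 0 := by
      apply hC.1
      simpa [hfg₀, hgk₀] using hy
    exact ⟨p x, by simp [hx]⟩
  · rintro ⟨a, rfl⟩
    exact hfg₀ a

lemma extendScalars_additive {R S : Type*} [CommRing R] [CommRing S] (f : R →+* S) :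
    (ModuleCat.extendScalars f).Additive where
  map_add {_ _ _ _} :=
    letI := f.toAlgebra
    ModuleCat.ExtendScalars.hom_ext fun _ => TensorProduct.tmul_add _ _ _

/-- A morphism of cochain complexes is a quasi-isomorphism if and only if its mapping cone is
acyclic. -/
lemma quasiIso_iff_acyclic_mappingCone {C : Type*} [Category* C] [Abelian C]
    {K L : CochainComplex C ℤ} (φ : K ⟶ L) :
    QuasiIso φ ↔ (CochainComplex.mappingCone φ).Acyclic := by
  rw [← HomotopyCategory.quotient_obj_mem_subcategoryAcyclic_iff_acyclic,
    ← HomologicalComplex.mem_quasiIso_iff, ← HomotopyCategory.quotient_map_mem_quasiIso_iff,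
    HomotopyCategory.quasiIso_eq_trW_subcategoryAcyclic]
  exact (HomotopyCategory.subcategoryAcyclic C).trW_iff_of_distinguished _
    (HomotopyCategory.mappingCone_triangleh_distinguished φ)

/-- A complex of finite projective modules over a Noetherian local ring is acyclic if its base
change to the residue field is. -/
lemma acyclic_of_acyclic_extendScalars_residueField {R : Type*} [CommRing R] [IsLocalRing R]
    [IsNoetherianRing R] (K : CochainComplex (ModuleCat R) ℤ)
    (hproj : ∀ i, Module.Projective R (K.X i)) (hfin : ∀ i, Module.Finite R (K.X i))
    (h : (((ModuleCat.extendScalars (residue R)).mapHomologicalComplex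
      (ComplexShape.up ℤ)).obj K).Acyclic) : K.Acyclic := by
  have hex (i : ℤ) : Function.Exact ((K.d (i - 1) i).hom.baseChange (ResidueField R))
      ((K.d i (i + 1)).hom.baseChange (ResidueField R)) := by
    have hi := h i
    rw [HomologicalComplex.exactAt_iff' _ (i - 1) i (i + 1) (by simp) (by simp),
      ShortComplex.ShortExact.moduleCat_exact_iff_function_exact] at hi
    exact hi
  intro i
  rw [HomologicalComplex.exactAt_iff' _ (i - 1) i (i + 1) (by simp) (by simp),
    ShortComplex.ShortExact.moduleCat_exact_iff_function_exact]
  have hex' := hex (i + 1)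
  rw [add_sub_cancel_right] at hex'
  have hK : Function.Exact (K.d (i - 1) i).hom (K.d i (i + 1)).hom :=
    exact_of_exact_baseChange_residueField
      (by rw [← ModuleCat.hom_comp, K.d_comp_d, ModuleCat.hom_zero])
      (by rw [← ModuleCat.hom_comp, K.d_comp_d, ModuleCat.hom_zero]) (hex i) hex'
  exact hK

/-- The terms of the mapping cone are products of terms of the source and of the target. -/
noncomputable def mappingConeXLinearEquiv {R : Type*} [Ring R]
    {K L : CochainComplex (ModuleCat R) ℤ} (φ : K ⟶ L) (i : ℤ) :
    (CochainComplex.mappingCone φ).X i ≃ₗ[R] K.X (i + 1) × L.X i :=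
  (HomologicalComplex.homotopyCofiber.XIsoBiprod φ i (i + 1) rfl ≪≫
    ModuleCat.biprodIsoProd _ _).toLinearEquiv

/-- Nakayama's lemma for perfect complexes: if `P` is a bounded
complex of finite free modules over a Noetherian local ring `O` and
`u : P → P` is a chain map whose derived reduction `u ⊗^L k` to the residue
field is an isomorphism in `D(k)`, then `u` is a quasi-isomorphism.  (Since
`P` is levelwise free, the derived reduction is computed by the levelwise
base change `extendScalars` along `O → k`.) -/
theorem stmt_7
    (O : Type) [CommRing O] [IsNoetherianRing O] [IsLocalRing O]
    (P : CochainComplex (ModuleCat O) ℤ)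
    (hPfree : ∀ i, Module.Free O (P.X i)) (hPfin : ∀ i, Module.Finite O (P.X i))
    (hPbdd : ∃ N : ℕ, ∀ i : ℤ, (N : ℤ) < |i| → Subsingleton (P.X i))
    (u : P ⟶ P)
    -- the derived reduction of u to the residue field is an isomorphism
    (hu : QuasiIso ((Functor.mapHomologicalComplex
      (ModuleCat.extendScalars (residue O : O →+* ResidueField O))
      (ComplexShape.up ℤ)).map u)) :
    QuasiIso u := by
  have := extendScalars_additive (residue O)
  rw [quasiIso_iff_acyclic_mappingCone] at hu ⊢
  refine acyclic_of_acyclic_extendScalars_residueField _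
    (fun i => .of_equiv (mappingConeXLinearEquiv u i).symm)
    (fun i => .equiv (mappingConeXLinearEquiv u i).symm) fun i => ?_
  exact (hu i).of_iso (CochainComplex.mappingCone.mapHomologicalComplexIso u
    (ModuleCat.extendScalars (residue O))).symm
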